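/- arXiv:1106.5149 — 2 statements merged into one kernel-verified Lean document; each statement's English description precedes it below -/
import Mathlib

section
/- Let n be an odd prime and r, s integers with s ≥ 1, 4s − r² > 0, 4s − r² not a perfect square, and n not dividing s·(4s − r²). Let λ and μ be integers with λ² + rλ + s ≡ 0 (mod n) and μ² + 1 ≡ 0 (mod n). Then for every integer k there exist integers k₁, k₂, k₃, k₄ such that k ≡ k₁ + k₂λ + k₃μ + k₄λμ (mod n) and max(|k₁|, |k₂|, |k₃|, |k₄|) < 103·√(1 + |r| + s)·n^(1/4). -/
namespace GLVAux


theorem norm_eq (z : GaussianInt) : z.norm = z.re ^ 2 + z.im ^ 2 := by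
  rw [Zsqrtd.norm_def]; ring

/-- Elements of the kernel of `ℤ[i] → ZMod n` have norm divisible by `n`. -/
theorem dvd_norm {n : ℕ} (m : ZMod n) (hm : m ^ 2 + 1 = 0) (z : GaussianInt)
    (hz : (z.re : ZMod n) + z.im * m = 0) : (n : ℤ) ∣ z.norm := by
  rw [← ZMod.intCast_zmod_eq_zero_iff_dvd, norm_eq]
  push_cast
  linear_combination ((z.re : ZMod n) - z.im * m) * hz + (z.im : ZMod n) ^ 2 * hm

/-- Evaluation at a square root of `-1`. -/
theorem exists_hom {n : ℕ} (m : ZMod n) (hm : m ^ 2 + 1 = 0) :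
    ∃ f : GaussianInt →+* ZMod n, ∀ z : GaussianInt, f z = (z.re : ZMod n) + z.im * m := by
  refine ⟨Zsqrtd.lift ⟨m, by push_cast; linear_combination hm⟩, fun z => ?_⟩
  simp [Zsqrtd.lift]

/-- Pigeonhole. -/
theorem pigeon (n : ℕ) (hn : n.Prime) (l m : ZMod n) :
    ∃ a b : GaussianInt, (a ≠ 0 ∨ b ≠ 0) ∧
      ((a.re : ZMod n) + a.im * m) + ((b.re : ZMod n) + b.im * m) * l = 0 ∧
      (a.norm + b.norm) ^ 2 ≤ 16 * n := by
  have : Fact n.Prime := ⟨hn⟩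
  obtain ⟨q, hq1, hq2⟩ : ∃ q : ℕ, q ^ 4 ≤ n ∧ n < (q + 1) ^ 4 := by
    refine ⟨Nat.sqrt (Nat.sqrt n), ?_, ?_⟩
    · have h1 := Nat.sqrt_le' n
      have h2 := Nat.sqrt_le' (Nat.sqrt n)
      calc _ = (Nat.sqrt (Nat.sqrt n) ^ 2) ^ 2 := by ring
        _ ≤ (Nat.sqrt n) ^ 2 := by gcongr
        _ ≤ n := h1
    · have h1 := Nat.lt_succ_sqrt' n
      have h2 := Nat.lt_succ_sqrt' (Nat.sqrt n)
      calc n < (Nat.sqrt n + 1) ^ 2 := h1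
        _ ≤ ((Nat.sqrt (Nat.sqrt n) + 1) ^ 2) ^ 2 := by gcongr; exact h2
        _ = _ := by ring
  let F : (Fin (q+1) × Fin (q+1)) × (Fin (q+1) × Fin (q+1)) → ZMod n := fun x =>
    ((x.1.1 : ℕ) + (x.1.2 : ℕ) * m) + ((x.2.1 : ℕ) + (x.2.2 : ℕ) * m) * l
  obtain ⟨x, y, hxy, he⟩ := Fintype.exists_ne_map_eq_of_card_lt F (by
    simp only [ZMod.card, Fintype.card_prod, Fintype.card_fin]
    calc n < (q+1)^4 := hq2
      _ = _ := by ring)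
  obtain ⟨⟨x1, x2⟩, ⟨x3, x4⟩⟩ := x
  obtain ⟨⟨y1, y2⟩, ⟨y3, y4⟩⟩ := y
  have key : ∀ u v : Fin (q+1), (((u : ℕ) : ℤ) - ((v : ℕ) : ℤ)) ^ 2 ≤ (q : ℤ) ^ 2 := by
    intro u v
    have hu := u.2
    have hv := v.2
    apply sq_le_sq'
    · omega
    · omega
  refine ⟨⟨(x1 : ℕ) - (y1 : ℕ), (x2 : ℕ) - (y2 : ℕ)⟩,
    ⟨(x3 : ℕ) - (y3 : ℕ), (x4 : ℕ) - (y4 : ℕ)⟩, ?_, ?_, ?_⟩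
  · by_contra! hc
    obtain ⟨h1, h2⟩ := hc
    rw [Zsqrtd.ext_iff] at h1 h2
    simp only [Zsqrtd.re_zero, Zsqrtd.im_zero] at h1 h2
    apply hxy
    simp only [Prod.mk.injEq, Fin.ext_iff]
    omega
  · simp only [F] at he
    push_cast
    linear_combination he
  · rw [norm_eq, norm_eq]
    simp only
    have h1 := key x1 y1
    have h2 := key x2 y2
    have h3 := key x3 y3
    have h4 := key x4 y4
    have hq : ((q : ℤ) ^ 4) ≤ n := by exact_mod_cast hq1
    calc _ ≤ (4 * (q : ℤ) ^ 2) ^ 2 := by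
          gcongr
          linarith
      _ = 16 * (q : ℤ) ^ 4 := by ring
      _ ≤ _ := by linarith

theorem nonvanish (r s : ℤ) (hpos : 0 < 4 * s - r ^ 2) (hnsq : ¬ IsSquare (4 * s - r ^ 2))
    (a b : GaussianInt) (h : a ^ 2 - (r : GaussianInt) * a * b + (s : GaussianInt) * b ^ 2 = 0) : a = 0 ∧ b = 0 := by
  by_cases hb : b = 0
  · subst hb
    simpa using h
  exfalso
  have hi : (⟨0, 1⟩ : GaussianInt) ^ 2 = -1 := by
    rw [pow_two]; ext <;> simp
  have hu : ((⟨0, 1⟩ : GaussianInt) * (2 * a - r * b)) ^ 2 = b ^ 2 * ((4 * s - r ^ 2 : ℤ) : GaussianInt) := by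
    push_cast
    linear_combination (2 * a - r * b) ^ 2 * hi - 4 * h
  have hd : b ∣ (⟨0, 1⟩ : GaussianInt) * (2 * a - r * b) := by
    rw [← IsIntegrallyClosed.pow_dvd_pow_iff (n := 2) two_ne_zero]
    exact ⟨_, hu⟩
  obtain ⟨t, ht⟩ := hd
  rw [ht, mul_pow] at hu
  have h2 := mul_left_cancel₀ (pow_ne_zero 2 hb) hu
  rw [pow_two, Zsqrtd.ext_iff] at h2
  simp only [Zsqrtd.re_mul, Zsqrtd.im_mul, Zsqrtd.re_intCast, Zsqrtd.im_intCast] at h2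
  obtain ⟨h3, h4⟩ := h2
  have h5 : t.re * t.im = 0 := by linarith
  rcases mul_eq_zero.1 h5 with h6 | h6
  · rw [h6] at h3
    nlinarith [mul_self_nonneg t.im]
  · rw [h6] at h3
    exact hnsq ⟨t.re, by linarith⟩

theorem upper (r s : ℤ) (hs : 1 ≤ s) (a b : GaussianInt) :
    (a ^ 2 - (r : GaussianInt) * a * b + (s : GaussianInt) * b ^ 2).norm ≤
      ((1 + |r| + s) * (a.norm + b.norm)) ^ 2 := by
  have hN : ∀ z : GaussianInt, ((z.norm : ℤ) : ℝ) = ‖(GaussianInt.toComplex z)‖ ^ 2 := by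
    intro z
    rw [GaussianInt.intCast_real_norm, Complex.normSq_eq_norm_sq]
  have : (((a ^ 2 - (r : GaussianInt) * a * b + (s : GaussianInt) * b ^ 2).norm : ℤ) : ℝ) ≤
      (((1 + |r| + s) * (a.norm + b.norm)) ^ 2 : ℤ) := by
    push_cast
    rw [hN, hN, hN]
    simp only [map_add, map_sub, map_mul, map_pow, map_intCast]
    set A := GaussianInt.toComplex a
    set B := GaussianInt.toComplex b
    have hs' : (1 : ℝ) ≤ s := by exact_mod_cast hs
    gcongr
    calc ‖A ^ 2 - r * A * B + s * B ^ 2‖ ≤ ‖A ^ 2‖ + ‖(r : ℂ) * A * B‖ + ‖(s : ℂ) * B ^ 2‖ :=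
          (norm_add_le _ _).trans (by gcongr; exact norm_sub_le _ _)
      _ = ‖A‖ ^ 2 + |(r : ℝ)| * (‖A‖ * ‖B‖) + s * ‖B‖ ^ 2 := by
          simp only [norm_mul, norm_pow, Complex.norm_intCast]
          rw [abs_of_nonneg (by linarith : (0 : ℝ) ≤ s)]
          ring
      _ ≤ _ := by
          have h1 : ‖A‖ * ‖B‖ ≤ ‖A‖ ^ 2 + ‖B‖ ^ 2 := by
            nlinarith [sq_nonneg (‖A‖ - ‖B‖), sq_nonneg (‖A‖), sq_nonneg (‖B‖)]
          have h2 := mul_le_mul_of_nonneg_left h1 (abs_nonneg (r : ℝ))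
          nlinarith [sq_nonneg (‖A‖), sq_nonneg (‖B‖)]
  exact_mod_cast this

/-- A reduced primitive vector. -/
theorem primitive (n : ℕ) (hn : n.Prime) (hbig : 16 < n) (l m : ZMod n) (hm : m ^ 2 + 1 = 0)
    (f : GaussianInt →+* ZMod n) (hf : ∀ z : GaussianInt, f z = (z.re : ZMod n) + z.im * m) :
    ∃ a b : GaussianInt, IsCoprime a b ∧ f a + f b * l = 0 ∧ (a.norm + b.norm) ^ 2 ≤ 16 * n := by
  have : Fact n.Prime := ⟨hn⟩
  obtain ⟨a, b, hab, h0, hN⟩ := pigeon n hn l m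
  rw [← hf, ← hf] at h0
  obtain ⟨g, hg⟩ : ∃ g, g = EuclideanDomain.gcd a b := ⟨_, rfl⟩
  obtain ⟨a', ha'⟩ : g ∣ a := hg ▸ EuclideanDomain.gcd_dvd_left a b
  obtain ⟨b', hb'⟩ : g ∣ b := hg ▸ EuclideanDomain.gcd_dvd_right a b
  have hg0 : g ≠ 0 := by
    rintro rfl
    simp at ha' hb'
    tauto
  have hbez := EuclideanDomain.gcd_eq_gcd_ab a b
  rw [← hg] at hbez
  have hgn : 0 < g.norm := GaussianInt.norm_pos.2 hg0
  have e1 : a.norm = g.norm * a'.norm := by rw [ha', Zsqrtd.norm_mul]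
  have e2 : b.norm = g.norm * b'.norm := by rw [hb', Zsqrtd.norm_mul]
  have hcop : IsCoprime a' b' := by
    refine ⟨EuclideanDomain.gcdA a b, EuclideanDomain.gcdB a b, ?_⟩
    apply mul_left_cancel₀ hg0
    generalize EuclideanDomain.gcdA a b = p at *
    generalize EuclideanDomain.gcdB a b = q at *
    linear_combination (-1 : GaussianInt) * hbez - p * ha' - q * hb'
  have hp1 : 1 ≤ a'.norm + b'.norm := by
    have h1 := GaussianInt.norm_nonneg a'
    have h2 := GaussianInt.norm_nonneg b'
    by_contra! hc
    have h3 : a' = 0 := GaussianInt.norm_eq_zero.1 (by linarith)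
    have h4 : b' = 0 := GaussianInt.norm_eq_zero.1 (by linarith)
    subst h3 h4
    obtain ⟨u, v, huv⟩ := hcop
    simp at huv
  rw [e1, e2, ← mul_add] at hN
  refine ⟨a', b', hcop, ?_, ?_⟩
  · rw [ha', hb', map_mul, map_mul, mul_assoc, ← mul_add] at h0
    rcases mul_eq_zero.1 h0 with h | h
    · exfalso
      have h3 := Int.le_of_dvd hgn (dvd_norm m hm g (by rw [← hf, h]))
      have h4 : (n : ℤ) ≤ g.norm * (a'.norm + b'.norm) := by nlinarith
      have h5 : (16 : ℤ) < n := by exact_mod_cast hbig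
      nlinarith
    · exact h
  · refine le_trans ?_ hN
    have : a'.norm + b'.norm ≤ g.norm * (a'.norm + b'.norm) := by nlinarith
    gcongr

/-- Integral form of the decomposition. -/
theorem core (n : ℕ) (hn : n.Prime) (hbig : 16 < n)
    (r s : ℤ) (hs : 1 ≤ s) (hpos : 0 < 4 * s - r ^ 2) (hnsq : ¬ IsSquare (4 * s - r ^ 2))
    (l m k : ZMod n) (hl : l ^ 2 + r * l + s = 0) (hm : m ^ 2 + 1 = 0) :
    ∃ x y : GaussianInt, k = ((x.re : ZMod n) + x.im * m) + ((y.re : ZMod n) + y.im * m) * l ∧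
      (x.norm + y.norm) ^ 2 ≤ 25 * (1 + |r| + s) ^ 2 * n := by
  have : Fact n.Prime := ⟨hn⟩
  obtain ⟨f, hf⟩ := exists_hom m hm
  obtain ⟨a, b, ⟨p, q, hpq⟩, h0, hN⟩ := primitive n hn hbig l m hm f hf
  -- generator of the kernel
  obtain ⟨nu, hnu, hnun⟩ : ∃ nu : GaussianInt, f nu = 0 ∧ nu.norm = n := by
    have h4 : n % 4 ≠ 3 := ZMod.mod_four_ne_three_of_sq_eq_neg_one (y := m)
      (by linear_combination hm)
    obtain ⟨u, v, huv⟩ := Nat.Prime.sq_add_sq h4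
    have huv' : ((u : ZMod n) ^ 2 + (v : ZMod n) ^ 2) = 0 := by
      have := congrArg (Nat.cast : ℕ → ZMod n) huv
      simpa using this
    have : ((u : ZMod n) + v * m) * (u - v * m) = 0 := by
      linear_combination huv' - (v : ZMod n) ^ 2 * hm
    have huz : (u : ℤ) ^ 2 + (v : ℤ) ^ 2 = n := by exact_mod_cast huv
    rcases mul_eq_zero.1 this with h | h
    · exact ⟨⟨u, v⟩, by rw [hf]; simpa using h, by rw [norm_eq]; simpa using huz⟩
    · exact ⟨⟨u, -v⟩, by rw [hf]; push_cast; linear_combination h,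
        by rw [norm_eq]; simpa using huz⟩
  have hn0 : (0 : ℤ) < n := by exact_mod_cast hn.pos
  have hnu0 : nu ≠ 0 := GaussianInt.norm_pos.1 (by rw [hnun]; exact hn0)
  obtain ⟨N, hNdef⟩ : ∃ N, N = a.norm + b.norm := ⟨_, rfl⟩
  rw [← hNdef] at hN
  -- lower bound
  have hlow : (n : ℤ) ≤ ((1 + |r| + s) * N) ^ 2 := by
    rw [hNdef]
    refine le_trans ?_ (upper r s hs a b)
    apply Int.le_of_dvd
    · rw [GaussianInt.norm_pos]
      intro h
      obtain ⟨rfl, rfl⟩ := nonvanish r s hpos hnsq a b h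
      simp at hpq
    · apply dvd_norm m hm
      rw [← hf]
      simp only [map_add, map_sub, map_mul, map_pow, map_intCast]
      linear_combination (f a - f b * l - r * f b) * h0 + (f b) ^ 2 * hl
  have hC : (0 : ℤ) < 1 + |r| + s := by positivity
  have hNnn : 0 ≤ N := by
    rw [hNdef]; exact add_nonneg (GaussianInt.norm_nonneg a) (GaussianInt.norm_nonneg b)
  have hNpos : 0 < N := by
    rcases hNnn.lt_or_eq with h | h
    · exact h
    · rw [← h] at hlow; simp at hlow; omega
  -- complementary vector (-q, p), determinant `a p + b q = 1`
  -- value of the form on the complementary vector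
  have hw : -f q + f p * l ≠ 0 := by
    intro h
    have h1 : f p * f a + f q * f b = 1 := by rw [← map_mul, ← map_mul, ← map_add, hpq, map_one]
    have hb0 : f b * (-f q + f p * l) = -1 := by linear_combination f p * h0 - h1
    rw [h, mul_zero] at hb0
    have : (1 : ZMod n) = 0 := by linear_combination hb0
    exact one_ne_zero this
  obtain ⟨c0, hc0⟩ : ∃ c0 : GaussianInt, f c0 = k / (-f q + f p * l) := by
    obtain ⟨z, hz⟩ := ZMod.intCast_surjective (k / (-f q + f p * l))
    exact ⟨(z : GaussianInt), by rw [map_intCast, hz]⟩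
  obtain ⟨c, hc⟩ : ∃ c, c = c0 % nu := ⟨_, rfl⟩
  have hcn : c.norm < n := by rw [hc, ← hnun]; exact GaussianInt.norm_mod_lt _ hnu0
  have hcf : f c * (-f q + f p * l) = k := by
    rw [hc, GaussianInt.mod_def, map_sub, map_mul, hnu, zero_mul, sub_zero, hc0]
    exact div_mul_cancel₀ _ hw
  have hNz : ((N : ℤ) : GaussianInt) ≠ 0 := by exact_mod_cast hNpos.ne'
  have hNs : ((N : ℤ) : GaussianInt) = a * star a + b * star b := by
    rw [hNdef]; push_cast; rw [Zsqrtd.norm_eq_mul_conj, Zsqrtd.norm_eq_mul_conj]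
  obtain ⟨h, hh⟩ : ∃ h, h = -(c * q) * star a + c * p * star b := ⟨_, rfl⟩
  obtain ⟨t, ht⟩ : ∃ t, t = h / ((N : ℤ) : GaussianInt) := ⟨_, rfl⟩
  have hmod := GaussianInt.norm_mod_lt h hNz
  rw [GaussianInt.mod_def, ← ht, Zsqrtd.norm_intCast] at hmod
  refine ⟨-(c * q) - t * a, c * p - t * b, ?_, ?_⟩
  · rw [← hf, ← hf]
    simp only [map_sub, map_neg, map_mul]
    linear_combination -hcf + f t * h0
  · obtain ⟨x, hx⟩ : ∃ x, x = -(c * q) - t * a := ⟨_, rfl⟩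
    obtain ⟨y, hy⟩ : ∃ y, y = c * p - t * b := ⟨_, rfl⟩
    rw [← hx, ← hy]
    have hdet : a * y - b * x = c := by
      rw [hx, hy]; linear_combination c * hpq
    have hin : x * star a + y * star b = h - N * t := by
      rw [hx, hy, hh, hNs]; ring
    have hlag : (x.norm + y.norm) * N =
        (a * y - b * x).norm + (x * star a + y * star b).norm := by
      rw [hNdef]
      simp only [norm_eq, Zsqrtd.re_add, Zsqrtd.im_add, Zsqrtd.re_sub, Zsqrtd.im_sub,
        Zsqrtd.re_mul, Zsqrtd.im_mul, Zsqrtd.re_star, Zsqrtd.im_star]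
      ring
    rw [hdet, hin] at hlag
    obtain ⟨M, hM⟩ : ∃ M, M = x.norm + y.norm := ⟨_, rfl⟩
    have hM0 : 0 ≤ M := by
      rw [hM]; exact add_nonneg (GaussianInt.norm_nonneg x) (GaussianInt.norm_nonneg y)
    rw [← hM] at hlag ⊢
    have hMN : M * N ≤ n + N * N := by linarith
    generalize 1 + |r| + s = C at *
    generalize (n : ℤ) = ν at *
    -- real square root of n
    have g0 : (0 : ℝ) ≤ ν := by exact_mod_cast hn0.le
    obtain ⟨w, hw0, hww⟩ : ∃ w : ℝ, 0 ≤ w ∧ w ^ 2 = ν := ⟨√ν, Real.sqrt_nonneg _, Real.sq_sqrt g0⟩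
    have gN : (0 : ℝ) < N := by exact_mod_cast hNpos
    have gC : (1 : ℝ) ≤ C := by exact_mod_cast hC
    have i1 : (N : ℝ) ≤ 4 * w := by
      apply le_of_sq_le_sq _ (by positivity)
      rw [mul_pow, hww]; norm_num
      exact_mod_cast hN
    have i2 : w ≤ C * N := by
      apply le_of_sq_le_sq _ (by positivity)
      rw [hww]
      exact_mod_cast hlow
    have i3 : (M : ℝ) * N ≤ w ^ 2 + N * N := by
      rw [hww]; exact_mod_cast hMN
    have i4 : (M : ℝ) ≤ 5 * C * w := by
      refine le_of_mul_le_mul_right (i3.trans ?_) gN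
      have j1 := mul_le_mul_of_nonneg_left i2 hw0
      have j2 := mul_le_mul_of_nonneg_right i1 gN.le
      have j3 : w * N ≤ C * (w * N) := le_mul_of_one_le_left (by positivity) gC
      nlinarith
    have i5 : (M : ℝ) ^ 2 ≤ (5 * C * w) ^ 2 :=
      pow_le_pow_left₀ (by exact_mod_cast hM0) i4 2
    rw [mul_pow, mul_pow, hww] at i5
    norm_num at i5
    exact_mod_cast i5

theorem bound (n : ℕ) (hn : 1 ≤ n) (C z T : ℤ) (hC : 1 ≤ C) (hzT : z ^ 2 ≤ T)
    (hT : T ^ 2 ≤ 25 * C ^ 2 * n) :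
    ((|z| : ℤ) : ℝ) < 103 * Real.sqrt (C : ℝ) * (n : ℝ) ^ ((1 : ℝ) / 4) := by
  have gC : (1 : ℝ) ≤ C := by exact_mod_cast hC
  have gn : (1 : ℝ) ≤ n := by exact_mod_cast hn
  obtain ⟨w, hw⟩ : ∃ w : ℝ, w = (n : ℝ) ^ ((1 : ℝ) / 4) := ⟨_, rfl⟩
  have hw0 : 0 < w := by rw [hw]; positivity
  have hw4 : w ^ 4 = n := by
    rw [hw, ← Real.rpow_natCast, ← Real.rpow_mul (by positivity)]; norm_num
  rw [← hw]
  have hC0 : 0 < √(C : ℝ) := Real.sqrt_pos.2 (by linarith)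
  have hCC : √(C : ℝ) ^ 2 = C := Real.sq_sqrt (by linarith)
  have h1 : (T : ℝ) ≤ 5 * C * w ^ 2 := by
    apply le_of_sq_le_sq _ (by positivity)
    have : (T : ℝ) ^ 2 ≤ 25 * C ^ 2 * n := by exact_mod_cast hT
    rw [← hw4] at this
    linarith
  have h2 : (z : ℝ) ^ 2 ≤ T := by exact_mod_cast hzT
  push_cast
  apply abs_lt_of_sq_lt_sq _ (by positivity)
  have h3 : 0 < C * w ^ 2 := by positivity
  calc (z : ℝ) ^ 2 ≤ 5 * C * w ^ 2 := h2.trans h1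
    _ < 103 ^ 2 * C * w ^ 2 := by nlinarith
    _ = _ := by rw [mul_pow, mul_pow, hCC]

end GLVAux

/-- Four-dimensional GLV decomposition (Theorem 3 of the paper, number-theoretic content):
any scalar `k` decomposes modulo `n` with coefficients bounded by `103·√(1+|r|+s)·n^(1/4)`. -/
theorem glv_four_dim_decomposition
    (n : ℕ) (hn : n.Prime) (hodd : Odd n)
    (r s : ℤ) (hs : 1 ≤ s)
    (hpos : 0 < 4 * s - r ^ 2)
    (hnsq : ¬ IsSquare (4 * s - r ^ 2))
    (hndvd : ¬ (n : ℤ) ∣ s * (4 * s - r ^ 2))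
    (lam mu : ℤ)
    (hlam : (n : ℤ) ∣ lam ^ 2 + r * lam + s)
    (hmu : (n : ℤ) ∣ mu ^ 2 + 1)
    (k : ℤ) :
    ∃ k₁ k₂ k₃ k₄ : ℤ,
      k ≡ k₁ + k₂ * lam + k₃ * mu + k₄ * lam * mu [ZMOD (n : ℤ)] ∧
      ((max (max |k₁| |k₂|) (max |k₃| |k₄|) : ℤ) : ℝ) <
        103 * Real.sqrt ((1 + |r| + s : ℤ) : ℝ) * (n : ℝ) ^ ((1 : ℝ) / 4) := by
  have hC : (1 : ℤ) ≤ 1 + |r| + s := by have := abs_nonneg r; linarith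
  have hn1 : 1 ≤ n := hn.pos
  rcases le_or_gt n 16 with hsm | hbig
  · refine ⟨k % n, 0, 0, 0, ?_, ?_⟩
    · simpa using (Int.mod_modEq k n).symm
    · have h1 := Int.emod_nonneg k (by omega : (n : ℤ) ≠ 0)
      have h2 := Int.emod_lt_of_pos k (by omega : (0 : ℤ) < n)
      have h3 : max (max |k % (n : ℤ)| |0|) (max |0| |0|) = k % (n : ℤ) := by
        simp [abs_of_nonneg h1, h1]
      rw [h3]
      have h4 : ((k % (n : ℤ) : ℤ) : ℝ) < 103 := by
        have : k % (n : ℤ) < 103 := by omega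
        exact_mod_cast this
      have h5 : 1 ≤ Real.sqrt ((1 + |r| + s : ℤ) : ℝ) := by
        rw [Real.one_le_sqrt]; exact_mod_cast hC
      have h6 : 1 ≤ (n : ℝ) ^ ((1 : ℝ) / 4) :=
        Real.one_le_rpow (by exact_mod_cast hn1) (by norm_num)
      nlinarith [mul_le_mul h5 h6 zero_le_one (by linarith)]
  · have hl : (lam : ZMod n) ^ 2 + r * lam + s = 0 := by
      have := (ZMod.intCast_zmod_eq_zero_iff_dvd _ n).2 hlam
      push_cast at this; exact this
    have hm : (mu : ZMod n) ^ 2 + 1 = 0 := by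
      have := (ZMod.intCast_zmod_eq_zero_iff_dvd _ n).2 hmu
      push_cast at this; exact this
    obtain ⟨x, y, h1, h2⟩ := GLVAux.core n hn hbig r s hs hpos hnsq lam mu k hl hm
    refine ⟨x.re, y.re, x.im, y.im, ?_, ?_⟩
    · rw [← ZMod.intCast_eq_intCast_iff]
      push_cast
      linear_combination h1
    · have B := fun z hz => GLVAux.bound n hn1 (1 + |r| + s) z _ hC hz h2
      rw [GLVAux.norm_eq, GLVAux.norm_eq] at B
      have q1 := sq_nonneg x.re
      have q2 := sq_nonneg x.im
      have q3 := sq_nonneg y.re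
      have q4 := sq_nonneg y.im
      rw [Int.cast_max, Int.cast_max, Int.cast_max]
      exact max_lt (max_lt (B _ (by linarith)) (B _ (by linarith)))
        (max_lt (B _ (by linarith)) (B _ (by linarith)))
end

section
/- Let n ≥ 1 and r, s be integers with 4s − r² > 0 and 4s − r² not a perfect square. For x = (x₁, x₂, x₃, x₄) ∈ ℤ⁴ set z₁ = x₁ + x₃·i and z₂ = x₂ + x₄·i in the Gaussian integers ℤ[i], and define N(x) = Nm(z₁² − r·z₁·z₂ + s·z₂²), where Nm(a + bi) = a² + b² is the Gaussian-integer norm. Let B⁴ = 4 + 4s² + 8s + 8|r| + 8|r|s + 2(r² + 2s) + 2|r² − 2s|. If x ≠ 0 and n divides N(x), then B⁴ · (max(|x₁|, |x₂|, |x₃|, |x₄|))⁴ ≥ n. -/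
theorem sq_add_sq_zero_aux (a b : ℤ) (h : a ^ 2 + b ^ 2 = 0) : a = 0 ∧ b = 0 := by
  have h1 : a ^ 2 = 0 := by linarith [sq_nonneg a, sq_nonneg b]
  have h2 : b ^ 2 = 0 := by linarith [sq_nonneg a, sq_nonneg b]
  exact ⟨pow_eq_zero_iff two_ne_zero |>.mp h1, pow_eq_zero_iff two_ne_zero |>.mp h2⟩

/-- Lemma 1 of the paper, specialized to the norm form of `ℤ[Φ,Ψ]` (Gaussian-integer
formulation): if `x = (x₁,x₂,x₃,x₄) ≠ 0` and `n` divides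
`N(x) = Nm(z₁² − r·z₁z₂ + s·z₂²)` with `z₁ = x₁ + x₃i`, `z₂ = x₂ + x₄i`, then
`B⁴·(max |xᵢ|)⁴ ≥ n`, where `B⁴` is the sum of the absolute values of the coefficients
of the quartic norm form. -/
theorem norm_form_lower_bound (n : ℤ) (hn : 1 ≤ n) (r s : ℤ)
    (hpos : 0 < 4 * s - r ^ 2) (hnsq : ¬ IsSquare (4 * s - r ^ 2))
    (x₁ x₂ x₃ x₄ : ℤ) (hx : ¬ (x₁ = 0 ∧ x₂ = 0 ∧ x₃ = 0 ∧ x₄ = 0))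
    (hdvd : n ∣ Zsqrtd.norm
      ((⟨x₁, x₃⟩ : Zsqrtd (-1)) ^ 2 -
        (r : Zsqrtd (-1)) * (⟨x₁, x₃⟩ : Zsqrtd (-1)) * (⟨x₂, x₄⟩ : Zsqrtd (-1)) +
        (s : Zsqrtd (-1)) * (⟨x₂, x₄⟩ : Zsqrtd (-1)) ^ 2)) :
    n ≤ (4 + 4 * s ^ 2 + 8 * s + 8 * |r| + 8 * |r| * s + 2 * (r ^ 2 + 2 * s) +
          2 * |r ^ 2 - 2 * s|) *
        (max (max |x₁| |x₂|) (max |x₃| |x₄|)) ^ 4 := by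
  obtain ⟨a, ha⟩ : ∃ a, a = x₁ ^ 2 - x₃ ^ 2 - r * (x₁ * x₂ - x₃ * x₄) + s * (x₂ ^ 2 - x₄ ^ 2) :=
    ⟨_, rfl⟩
  obtain ⟨b, hb⟩ : ∃ b, b = 2 * x₁ * x₃ - r * (x₁ * x₄ + x₃ * x₂) + 2 * s * x₂ * x₄ := ⟨_, rfl⟩
  have hN : Zsqrtd.norm
      ((⟨x₁, x₃⟩ : Zsqrtd (-1)) ^ 2 -
        (r : Zsqrtd (-1)) * (⟨x₁, x₃⟩ : Zsqrtd (-1)) * (⟨x₂, x₄⟩ : Zsqrtd (-1)) +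
        (s : Zsqrtd (-1)) * (⟨x₂, x₄⟩ : Zsqrtd (-1)) ^ 2) = a ^ 2 + b ^ 2 := by
    rw [Zsqrtd.norm_def, ha, hb]
    simp [pow_two]
    ring
  rw [hN] at hdvd
  have hne : a ^ 2 + b ^ 2 ≠ 0 := by
    intro h0
    obtain ⟨ha0, hb0⟩ := sq_add_sq_zero_aux _ _ h0
    obtain ⟨p, hp⟩ : ∃ p, p = (2 * x₁ - r * x₂) * x₂ + (2 * x₃ - r * x₄) * x₄ := ⟨_, rfl⟩
    obtain ⟨q, hq⟩ : ∃ q, q = (2 * x₃ - r * x₄) * x₂ - (2 * x₁ - r * x₂) * x₄ := ⟨_, rfl⟩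
    have h1 : p ^ 2 - q ^ 2 + (4 * s - r ^ 2) * (x₂ ^ 2 + x₄ ^ 2) ^ 2 = 0 := by
      have : p ^ 2 - q ^ 2 + (4 * s - r ^ 2) * (x₂ ^ 2 + x₄ ^ 2) ^ 2
          = 4 * a * (x₂ ^ 2 - x₄ ^ 2) + 8 * b * x₂ * x₄ := by
        rw [hp, hq, ha, hb]; ring
      rw [this, ha0, hb0]; ring
    have h2 : p * q = 0 := by
      have : p * q = 2 * b * (x₂ ^ 2 - x₄ ^ 2) - 4 * a * x₂ * x₄ := by
        rw [hp, hq, ha, hb]; ring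
      rw [this, ha0, hb0]; ring
    have hC : x₂ ^ 2 + x₄ ^ 2 = 0 := by
      by_contra hC
      have hC2 : 0 < (x₂ ^ 2 + x₄ ^ 2) ^ 2 := by positivity
      have hpos2 := mul_pos hpos hC2
      rcases mul_eq_zero.mp h2 with h | h
      · rw [h] at h1
        have h3 : q ^ 2 = (x₂ ^ 2 + x₄ ^ 2) ^ 2 * (4 * s - r ^ 2) := by linarith
        have h4 : (x₂ ^ 2 + x₄ ^ 2) ∣ q :=
          (Int.pow_dvd_pow_iff two_ne_zero).mp ⟨_, h3⟩
        obtain ⟨k, hk⟩ := h4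
        apply hnsq
        refine ⟨k, mul_left_cancel₀ hC2.ne' ?_⟩
        rw [← h3, hk]; ring
      · rw [h] at h1
        linarith [sq_nonneg p]
    obtain ⟨e2, e4⟩ := sq_add_sq_zero_aux _ _ hC
    have hA : (x₁ ^ 2 + x₃ ^ 2) ^ 2 = 0 := by
      rw [e2, e4] at ha hb
      have : (x₁ ^ 2 + x₃ ^ 2) ^ 2 = a ^ 2 + b ^ 2 := by rw [ha, hb]; ring
      rw [this, h0]
    have hA' := pow_eq_zero_iff two_ne_zero |>.mp hA
    obtain ⟨e1, e3⟩ := sq_add_sq_zero_aux _ _ hA'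
    exact hx ⟨e1, e2, e3, e4⟩
  have hle : n ≤ a ^ 2 + b ^ 2 := Int.le_of_dvd (by positivity) hdvd
  refine hle.trans ?_
  obtain ⟨M, hM⟩ : ∃ M, M = max (max |x₁| |x₂|) (max |x₃| |x₄|) := ⟨_, rfl⟩
  rw [← hM]
  have b1 : x₁ ^ 2 ≤ M ^ 2 := sq_le_sq.mpr ((by simp [hM] : |x₁| ≤ M).trans (le_abs_self M))
  have b2 : x₂ ^ 2 ≤ M ^ 2 := sq_le_sq.mpr ((by simp [hM] : |x₂| ≤ M).trans (le_abs_self M))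
  have b3 : x₃ ^ 2 ≤ M ^ 2 := sq_le_sq.mpr ((by simp [hM] : |x₃| ≤ M).trans (le_abs_self M))
  have b4 : x₄ ^ 2 ≤ M ^ 2 := sq_le_sq.mpr ((by simp [hM] : |x₄| ≤ M).trans (le_abs_self M))
  obtain ⟨A, hA⟩ : ∃ A, A = x₁ ^ 2 + x₃ ^ 2 := ⟨_, rfl⟩
  obtain ⟨C, hC⟩ : ∃ C, C = x₂ ^ 2 + x₄ ^ 2 := ⟨_, rfl⟩
  obtain ⟨P, hP⟩ : ∃ P, P = x₁ * x₂ + x₃ * x₄ := ⟨_, rfl⟩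
  have hs : 0 ≤ s := by linarith [sq_nonneg r]
  have A0 : 0 ≤ A := by rw [hA]; positivity
  have C0 : 0 ≤ C := by rw [hC]; positivity
  have AM : A ≤ 2 * M ^ 2 := by linarith
  have CM : C ≤ 2 * M ^ 2 := by linarith
  have T0 : 0 ≤ 2 * M ^ 2 := by positivity
  have PAC : P ^ 2 ≤ A * C := by
    have : A * C = P ^ 2 + (x₁ * x₄ - x₃ * x₂) ^ 2 := by rw [hA, hC, hP]; ring
    linarith [sq_nonneg (x₁ * x₄ - x₃ * x₂)]
  have key : a ^ 2 + b ^ 2 = A ^ 2 + r ^ 2 * (A * C) + s ^ 2 * C ^ 2 + 2 * (-(r * P)) * A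
      + 2 * s * ((-(r * P)) * C) + 2 * s * (2 * P ^ 2 - A * C) := by
    rw [ha, hb, hA, hC, hP]; ring
  rw [key]
  obtain ⟨T, hT⟩ : ∃ T, T = 2 * M ^ 2 := ⟨_, rfl⟩
  have hM4 : M ^ 4 * 4 = T ^ 2 := by rw [hT]; ring
  rw [← hT] at AM CM T0
  have AA : A ^ 2 ≤ T ^ 2 := pow_le_pow_left₀ A0 AM 2
  have CC : C ^ 2 ≤ T ^ 2 := pow_le_pow_left₀ C0 CM 2
  have AC : A * C ≤ T ^ 2 := by rw [pow_two]; exact mul_le_mul AM CM C0 T0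
  have PT : |P| ≤ T := abs_le_of_sq_le_sq (PAC.trans AC) T0
  have R : -(r * P) ≤ |r| * T :=
    (neg_le_abs _).trans (by rw [abs_mul]; exact mul_le_mul_of_nonneg_left PT (abs_nonneg r))
  have RT : 0 ≤ |r| * T := mul_nonneg (abs_nonneg r) T0
  have RA : (-(r * P)) * A ≤ |r| * T * T := mul_le_mul R AM A0 RT
  have RC : (-(r * P)) * C ≤ |r| * T * T := mul_le_mul R CM C0 RT
  have t1 := mul_le_mul_of_nonneg_left RC hs
  have t2 := mul_le_mul_of_nonneg_left AC (sq_nonneg r)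
  have t3 := mul_le_mul_of_nonneg_left CC (sq_nonneg s)
  have t4 : s * (2 * P ^ 2 - A * C) ≤ s * T ^ 2 :=
    mul_le_mul_of_nonneg_left (by linarith) hs
  have t5 : 0 ≤ (|r ^ 2 - 2 * s| - (r ^ 2 - 2 * s)) * M ^ 4 :=
    mul_nonneg (sub_nonneg.mpr (le_abs_self _)) (by positivity)
  have fin : A ^ 2 + r ^ 2 * (A * C) + s ^ 2 * C ^ 2 + 2 * (-(r * P)) * A
      + 2 * s * ((-(r * P)) * C) + 2 * s * (2 * P ^ 2 - A * C)
      ≤ (1 + r ^ 2 + s ^ 2 + 2 * |r| + 2 * |r| * s + 2 * s) * T ^ 2 := by linarith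
  rw [← hM4] at fin
  linarith
end
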